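/- Let n ≥ 1. For every invertible 2×2 complex matrix A and every nonzero v ∈ ℂ², the Veronese point Ψₙ(v) lies in the hyperplane ϱₙ(A)·span{e₀, e₁, …, e_{n−1}} of ℂ^{n+1} if and only if v lies in the line spanned by A·e₀ in ℂ². In particular, each such hyperplane (an osculating hyperplane of the Veronese curve) intersects the Veronese curve 𝒞ₙ in exactly one point. -/

import Mathlib

open Matrix Filter Topology

/-- The Veronese lift `Ψₙ : ℂ² → ℂ^{n+1}`, whose `k`-th coordinate at `(x, y)` is
`C(n,k) · x^(n-k) · y^k`. -/
noncomputable def veronese (n : ℕ) (v : Fin 2 → ℂ) : Fin (n + 1) → ℂ :=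
  fun k => (n.choose (k : ℕ) : ℂ) * v 0 ^ (n - (k : ℕ)) * v 1 ^ (k : ℕ)

/-- The matrix `ϱₙ(A)`: the n-th symmetric power of the 2×2 matrix `A` written in the
Veronese basis, given by the explicit entry formula. -/
noncomputable def rho (n : ℕ) (A : Matrix (Fin 2) (Fin 2) ℂ) :
    Matrix (Fin (n + 1)) (Fin (n + 1)) ℂ :=
  fun m j =>
    ((n.choose (m : ℕ) : ℂ) / (n.choose (j : ℕ) : ℂ)) *
      ∑ l ∈ Finset.Icc ((j : ℕ) - (n - (m : ℕ))) (min (j : ℕ) (m : ℕ)),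
        (((n - (m : ℕ)).choose ((j : ℕ) - l) : ℂ) * (((m : ℕ).choose l : ℕ) : ℂ)) *
          A 0 0 ^ (n - (m : ℕ) - ((j : ℕ) - l)) * A 0 1 ^ ((j : ℕ) - l) *
          A 1 0 ^ ((m : ℕ) - l) * A 1 1 ^ l

/-- `ϱₙ(A)` is the matrix induced by `A` on Veronese points. -/
theorem rho_mulVec_veronese (n : ℕ) (A : Matrix (Fin 2) (Fin 2) ℂ) (v : Fin 2 → ℂ) :
    rho n A *ᵥ veronese n v = veronese n (A *ᵥ v) := by
  ext m
  obtain ⟨m, hm⟩ := m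
  obtain ⟨N, rfl⟩ : ∃ N, n = N + m := ⟨n - m, by omega⟩
  have hAv : ∀ i, (A *ᵥ v) i = A i 1 * v 1 + A i 0 * v 0 := fun i => by
    simp [Matrix.mulVec, dotProduct, Fin.sum_univ_two, add_comm]
  simp only [veronese, hAv, Nat.add_sub_cancel]
  rw [mul_assoc, add_pow, add_pow, Finset.sum_mul_sum, Finset.sum_sigma']
  simp only [Matrix.mulVec, dotProduct, rho, veronese, Nat.add_sub_cancel]
  rw [Fin.sum_univ_eq_sum_range (fun j => ((N + m).choose m : ℂ) / ((N + m).choose j : ℂ) *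
      (∑ l ∈ Finset.Icc (j - N) (min j m), ((N.choose (j - l) : ℂ) * (m.choose l : ℂ)) *
          A 0 0 ^ (N - (j - l)) * A 0 1 ^ (j - l) * A 1 0 ^ (m - l) * A 1 1 ^ l) *
      (((N + m).choose j : ℂ) * v 0 ^ (N + m - j) * v 1 ^ j)) (N + m + 1)]
  have hterm : ∀ j ∈ Finset.range (N + m + 1), ((N + m).choose m : ℂ) / ((N + m).choose j : ℂ) *
      (∑ l ∈ Finset.Icc (j - N) (min j m), ((N.choose (j - l) : ℂ) * (m.choose l : ℂ)) *
          A 0 0 ^ (N - (j - l)) * A 0 1 ^ (j - l) * A 1 0 ^ (m - l) * A 1 1 ^ l) *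
      (((N + m).choose j : ℂ) * v 0 ^ (N + m - j) * v 1 ^ j) =
      ((N + m).choose m : ℂ) * ∑ l ∈ Finset.Icc (j - N) (min j m),
        ((N.choose (j - l) : ℂ) * (m.choose l : ℂ)) *
          A 0 0 ^ (N - (j - l)) * A 0 1 ^ (j - l) * A 1 0 ^ (m - l) * A 1 1 ^ l *
          (v 0 ^ (N + m - j) * v 1 ^ j) := by
    intro j hj
    have hchoose : ((N + m).choose j : ℂ) ≠ 0 := by
      have := Nat.choose_pos (Nat.lt_succ_iff.mp (Finset.mem_range.mp hj))
      exact_mod_cast this.ne'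
    rw [← Finset.sum_mul]
    field_simp
  rw [Finset.sum_congr rfl hterm, ← Finset.mul_sum, Finset.sum_sigma']
  congr 1
  refine Finset.sum_bij' (fun p _ => ⟨p.1 - p.2, p.2⟩) (fun q _ => ⟨q.1 + q.2, q.2⟩)
    ?_ ?_ ?_ ?_ ?_
  · rintro ⟨j, l⟩ h
    simp only [Finset.mem_sigma, Finset.mem_range, Finset.mem_Icc] at h ⊢
    omega
  · rintro ⟨p, l⟩ h
    simp only [Finset.mem_sigma, Finset.mem_range, Finset.mem_Icc] at h ⊢
    omega
  · rintro ⟨j, l⟩ h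
    simp only [Finset.mem_sigma, Finset.mem_range, Finset.mem_Icc] at h
    simp only [Sigma.mk.injEq, heq_eq_eq, and_true]
    omega
  · rintro ⟨p, l⟩ h
    simp
  · rintro ⟨j, l⟩ h
    simp only [Finset.mem_sigma, Finset.mem_range, Finset.mem_Icc] at h
    have hx : N + m - j = (N - (j - l)) + (m - l) := by omega
    have hy : v 1 ^ j = v 1 ^ (j - l) * v 1 ^ l := by
      rw [← pow_add]
      congr 1
      omega
    simp only [hx, hy, mul_pow, pow_add]
    ring

/-- A linear form on `ℂ^{n+1}` whose value at each Veronese point is `v₁ⁿ` vanishes on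
`e₀, …, e_{n-1}`. -/
theorem eq_zero_of_dotProduct_veronese {n : ℕ} {c : Fin (n + 1) → ℂ}
    (hc : ∀ v : Fin 2 → ℂ, c ⬝ᵥ veronese n v = v 1 ^ n) (i : Fin n) : c i.castSucc = 0 := by
  have hpoly : ∑ j : Fin (n + 1), Polynomial.monomial (j : ℕ) (c j * (n.choose j : ℂ)) =
      Polynomial.X ^ n := by
    refine Polynomial.funext fun t => ?_
    have h := hc ![1, t]
    simp only [veronese, dotProduct, Matrix.cons_val_zero, Matrix.cons_val_one, one_pow,
      mul_one] at h
    simp only [Polynomial.eval_finsetSum, Polynomial.eval_monomial, Polynomial.eval_pow,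
      Polynomial.eval_X, ← h, mul_assoc]
  have h := congrArg (fun p => Polynomial.coeff p (i : ℕ)) hpoly
  simp only [Polynomial.finsetSum_coeff, Polynomial.coeff_monomial, Polynomial.coeff_X_pow,
    i.isLt.ne, if_false] at h
  rw [Fintype.sum_eq_single i.castSucc
    (fun j hj => if_neg fun hji : (j : ℕ) = i => hj (Fin.ext hji)), Fin.val_castSucc,
    if_pos rfl] at h
  have hchoose : (n.choose i : ℂ) ≠ 0 := by
    exact_mod_cast (Nat.choose_pos i.isLt.le).ne'
  exact (mul_eq_zero.mp h).resolve_right hchoose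

/-- The Veronese point `Ψₙ(v)` lies in the osculating hyperplane
`ϱₙ(A) · span{e₀, …, e_{n-1}}` if and only if `v` lies in the line spanned by `A·e₀`;
in particular each osculating hyperplane meets the Veronese curve in exactly one point. -/
theorem veronese_mem_osculating_hyperplane_iff (n : ℕ) (hn : 1 ≤ n)
    (A : Matrix (Fin 2) (Fin 2) ℂ) (hA : IsUnit A) (v : Fin 2 → ℂ) (hv : v ≠ 0) :
    veronese n v ∈ Submodule.span ℂ
        (Set.range fun i : Fin n => rho n A *ᵥ Pi.single (Fin.castSucc i) (1 : ℂ)) ↔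
      v ∈ Submodule.span ℂ ({A *ᵥ Pi.single (0 : Fin 2) (1 : ℂ)} : Set (Fin 2 → ℂ)) := by
  have hdet : IsUnit A.det := (Matrix.isUnit_iff_isUnit_det A).mp hA
  constructor
  · intro h
    have hform : ∀ w : Fin 2 → ℂ,
        (rho n A⁻¹ (Fin.last n) ᵥ* rho n A) ⬝ᵥ veronese n w = w 1 ^ n := by
      intro w
      rw [← Matrix.dotProduct_mulVec, rho_mulVec_veronese]
      change (rho n A⁻¹ *ᵥ veronese n (A *ᵥ w)) (Fin.last n) = _
      rw [rho_mulVec_veronese, Matrix.mulVec_mulVec, Matrix.nonsing_inv_mul A hdet,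
        Matrix.one_mulVec]
      simp [veronese]
    have hle : Submodule.span ℂ
        (Set.range fun i : Fin n => rho n A *ᵥ Pi.single (Fin.castSucc i) (1 : ℂ)) ≤
        LinearMap.ker (LinearMap.proj (Fin.last n) ∘ₗ (rho n A⁻¹).mulVecLin) := by
      rw [Submodule.span_le]
      rintro _ ⟨i, rfl⟩
      change rho n A⁻¹ (Fin.last n) ⬝ᵥ (rho n A *ᵥ Pi.single (Fin.castSucc i) (1 : ℂ)) = 0
      rw [Matrix.dotProduct_mulVec, dotProduct_single_one]
      exact eq_zero_of_dotProduct_veronese hform i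
    have hlast : (rho n A⁻¹ *ᵥ veronese n v) (Fin.last n) = 0 := hle h
    have hw : (A⁻¹ *ᵥ v) 1 = 0 := by
      rw [rho_mulVec_veronese] at hlast
      simpa [veronese, show n ≠ 0 by omega] using hlast
    refine Submodule.mem_span_singleton.mpr ⟨(A⁻¹ *ᵥ v) 0, ?_⟩
    have hw' : (A⁻¹ *ᵥ v) 0 • Pi.single (0 : Fin 2) (1 : ℂ) = A⁻¹ *ᵥ v := by
      ext i
      fin_cases i <;> simp [hw]
    rw [← Matrix.mulVec_smul, hw', Matrix.mulVec_mulVec, Matrix.mul_nonsing_inv A hdet,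
      Matrix.one_mulVec]
  · intro h
    obtain ⟨c, rfl⟩ := Submodule.mem_span_singleton.mp h
    have hver : veronese n (c • Pi.single (0 : Fin 2) (1 : ℂ)) =
        c ^ n • Pi.single (Fin.castSucc (⟨0, hn⟩ : Fin n)) (1 : ℂ) := by
      ext k
      rcases Fin.eq_zero_or_eq_succ k with rfl | ⟨k, rfl⟩
      · simp [veronese]
      · simp [veronese, Fin.ext_iff]
    rw [← Matrix.mulVec_smul, ← rho_mulVec_veronese, hver, Matrix.mulVec_smul]
    exact Submodule.smul_mem _ _ (Submodule.subset_span ⟨⟨0, hn⟩, rfl⟩)
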